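/- Let N = (N_1,…,N_d) be a nilpotent commuting row contraction on a Hilbert space H, Ξ = {α ∈ ℕ^d : N^α ≠ 0}, and L ∈ ℕ with Ξ ⊆ {α : |α| ≤ L}. Assume: (a) there is a unit cyclic vector ξ for N; (b) there is γ > 0 such that for each t ∈ [0,2π] there is invertible Y_t with ‖Y_t‖ ≤ γ, Y_t⁻¹ξ = ξ, and Y_t N Y_t⁻¹ = e^{it}N componentwise; (c) there is ε > 0 with (|α|!/α!)‖N^α ξ‖² ≥ 1 − ε for all α ∈ Ξ. Then for every family (c_α)_{α∈Ξ} of scalars, setting h = ∑_{α∈Ξ} c_α (|α|!/α!)^{1/2} N^α ξ, one has ((1 − ε·card Ξ)/((L+1)γ²)) · ∑_{α∈Ξ}|c_α|² ≤ ‖h‖² ≤ (L+1) · ∑_{α∈Ξ}|c_α|². -/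

import Mathlib

open ContinuousLinearMap

/-- `N^α = N_1^{α_1} ⋯ N_d^{α_d}`. -/
noncomputable def opProd {H : Type*} [NormedAddCommGroup H] [InnerProductSpace ℂ H]
    {d : ℕ} (T : Fin d → H →L[ℂ] H) (α : Fin d → ℕ) : H →L[ℂ] H :=
  (List.ofFn fun i => (T i) ^ (α i)).prod

/-- The multinomial-type coefficient `|α|!/α!`. -/
noncomputable def mcoef {d : ℕ} (α : Fin d → ℕ) : ℝ :=
  ((∑ i, α i).factorial : ℝ) / (∏ i, ((α i).factorial : ℝ))

lemma inner_self_eq_ofReal_norm_sq {H : Type*} [NormedAddCommGroup H] [InnerProductSpace ℂ H]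
    (x : H) : inner ℂ x x = ((‖x‖ ^ 2 : ℝ) : ℂ) := by
  rw [inner_self_eq_norm_sq_to_K]
  push_cast
  rfl

open Finset in
/-- Orthogonality of characters of `ℤ/n`. -/
lemma sum_pow_mul_conj_pow_of_isPrimitiveRoot {n : ℕ} {ω : ℂ} (hω : IsPrimitiveRoot ω n)
    {l m : ℕ} (hl : l < n) (hm : m < n) :
    ∑ k ∈ range n, (starRingEnd ℂ) ((ω ^ k) ^ l) * (ω ^ k) ^ m = if l = m then (n : ℂ) else 0 := by
  have hn : n ≠ 0 := by omega
  have hω0 : ω ≠ 0 := hω.ne_zero hn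
  have hconj : (starRingEnd ℂ) ω = ω⁻¹ := by
    rw [Complex.inv_def, Complex.normSq_eq_norm_sq, hω.norm'_eq_one hn]
    simp
  set z : ℂ := ω⁻¹ ^ l * ω ^ m with hz
  have hterm : ∀ k, (starRingEnd ℂ) ((ω ^ k) ^ l) * (ω ^ k) ^ m = z ^ k := by
    intro k
    rw [map_pow, map_pow, hconj, hz, mul_pow]
    ring
  simp_rw [hterm]
  split_ifs with h
  · subst h
    have : z = 1 := by rw [hz, ← mul_pow, inv_mul_cancel₀ hω0, one_pow]
    simp [this]
  · have hz1 : z ≠ 1 := by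
      intro hz1
      apply h
      refine hω.pow_inj hl hm ?_
      have : ω ^ l * z = ω ^ m := by
        rw [hz, ← mul_assoc, ← mul_pow, mul_inv_cancel₀ hω0, one_pow, one_mul]
      rw [← this, hz1, mul_one]
    have hzn : z ^ n = 1 := by
      rw [hz, mul_pow, ← pow_mul, ← pow_mul, mul_comm l, mul_comm m, pow_mul, pow_mul, inv_pow,
        hω.pow_eq_one]
      simp
    rw [geom_sum_eq hz1, hzn, sub_self, zero_div]

open Finset in
/-- Parseval's identity for the discrete Fourier transform of vectors. -/
lemma sum_norm_sq_fourier {H : Type*} [NormedAddCommGroup H] [InnerProductSpace ℂ H]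
    {n : ℕ} {ω : ℂ} (hω : IsPrimitiveRoot ω n) (h : ℕ → H) :
    ∑ k ∈ range n, ‖∑ l ∈ range n, (ω ^ k) ^ l • h l‖ ^ 2 = n * ∑ l ∈ range n, ‖h l‖ ^ 2 := by
  have key : ∑ k ∈ range n, (inner ℂ (∑ l ∈ range n, (ω ^ k) ^ l • h l)
      (∑ l ∈ range n, (ω ^ k) ^ l • h l) : ℂ) = n * ∑ l ∈ range n, inner ℂ (h l) (h l) := by
    simp_rw [sum_inner, inner_sum, inner_smul_left, inner_smul_right]
    rw [sum_comm, mul_sum]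
    refine sum_congr rfl fun l hl => ?_
    rw [sum_comm]
    have : ∀ m ∈ range n, ∑ k ∈ range n, (starRingEnd ℂ) ((ω ^ k) ^ l) *
        ((ω ^ k) ^ m * inner ℂ (h l) (h m)) = if l = m then n * inner ℂ (h l) (h m) else 0 := by
      intro m hm
      simp_rw [← mul_assoc]
      rw [← sum_mul, sum_pow_mul_conj_pow_of_isPrimitiveRoot hω (mem_range.1 hl) (mem_range.1 hm)]
      split_ifs <;> simp
    rw [sum_congr rfl this, sum_ite_eq, if_pos hl]
  simp_rw [inner_self_eq_ofReal_norm_sq] at key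
  exact_mod_cast key

open Finset in
/-- A contraction that is almost isometric on each vector of an orthonormal basis is bounded below:
the defect `1 - A†A` is dominated by its trace. -/
lemma gram_lower_bound {H ι : Type*} [NormedAddCommGroup H] [InnerProductSpace ℂ H]
    [CompleteSpace H] [Fintype ι] (u : ι → H) {ε : ℝ}
    (hcontr : ∀ c : ι → ℂ, ‖∑ i, c i • u i‖ ^ 2 ≤ ∑ i, ‖c i‖ ^ 2)
    (hbelow : ∀ i, 1 - ε ≤ ‖u i‖ ^ 2) (c : ι → ℂ) :
    (1 - ε * Fintype.card ι) * ∑ i, ‖c i‖ ^ 2 ≤ ‖∑ i, c i • u i‖ ^ 2 := by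
  classical
  let A : EuclideanSpace ℂ ι →L[ℂ] H := LinearMap.toContinuousLinearMap
    ((Fintype.linearCombination ℂ u).comp (EuclideanSpace.equiv ι ℂ).toLinearMap)
  have hA : ∀ x : EuclideanSpace ℂ ι, A x = ∑ i, x i • u i := fun x => by
    simp [A, Fintype.linearCombination_apply]
  let T : EuclideanSpace ℂ ι →L[ℂ] EuclideanSpace ℂ ι := 1 - adjoint A ∘L A
  have hTx : ∀ x, inner ℂ (T x) x = ((‖x‖ ^ 2 - ‖A x‖ ^ 2 : ℝ) : ℂ) := by
    intro x
    simp only [T, sub_apply, one_apply_eq_self, comp_apply, inner_sub_left, adjoint_inner_left,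
      inner_self_eq_ofReal_norm_sq, Complex.ofReal_sub]
  have hT : T.IsPositive := by
    rw [isPositive_iff_complex]
    intro x
    have h := hcontr x
    rw [← hA, ← EuclideanSpace.norm_sq_eq] at h
    rw [hTx]
    exact ⟨rfl, sub_nonneg.2 h⟩
  obtain ⟨B, hB⟩ := CStarAlgebra.nonneg_iff_eq_star_mul_self.mp
    ((nonneg_iff_isPositive T).2 hT)
  have hBx : ∀ x, ‖B x‖ ^ 2 = ‖x‖ ^ 2 - ‖A x‖ ^ 2 := by
    intro x
    have h1 := hTx x
    rw [hB, star_eq_adjoint, mul_apply_eq_comp, adjoint_inner_left, inner_self_eq_ofReal_norm_sq] at h1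
    exact_mod_cast h1
  let x : EuclideanSpace ℂ ι := WithLp.toLp 2 c
  have hxn : ‖x‖ ^ 2 = ∑ i, ‖c i‖ ^ 2 := by simp [x, EuclideanSpace.norm_sq_eq]
  have hAx : A x = ∑ i, c i • u i := by simp [hA, x]
  have hbasis : ∀ i, ‖B (EuclideanSpace.single i 1)‖ ^ 2 ≤ ε := by
    intro i
    have h1 : A (EuclideanSpace.single i 1) = u i := by
      rw [hA, sum_eq_single i] <;> simp +contextual
    rw [hBx, h1]
    have := hbelow i
    simp only [PiLp.norm_single, norm_one]
    linarith
  have hsum : B x = ∑ i, c i • B (EuclideanSpace.single i 1) := by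
    have : x = ∑ i, c i • EuclideanSpace.single i (1 : ℂ) := by
      ext j
      simp [x, Pi.single_apply]
    conv_lhs => rw [this]
    simp
  have h2 : ‖B x‖ ≤ ∑ i, ‖c i‖ * ‖B (EuclideanSpace.single i 1)‖ := by
    rw [hsum]
    exact (norm_sum_le _ _).trans_eq (by simp_rw [norm_smul])
  have h3 : ‖B x‖ ^ 2 ≤ (∑ i, ‖c i‖ ^ 2) * (Fintype.card ι * ε) := by
    calc ‖B x‖ ^ 2 ≤ (∑ i, ‖c i‖ * ‖B (EuclideanSpace.single i 1)‖) ^ 2 := by gcongr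
      _ ≤ (∑ i, ‖c i‖ ^ 2) * ∑ i, ‖B (EuclideanSpace.single i 1)‖ ^ 2 :=
        sum_mul_sq_le_sq_mul_sq _ _ _
      _ ≤ (∑ i, ‖c i‖ ^ 2) * ∑ _i : ι, ε := by gcongr with i; exact hbasis i
      _ = _ := by simp
  rw [hBx, hxn, hAx] at h3
  linarith

/-- Ordered products of pairwise commuting families multiply componentwise. -/
lemma List.prod_ofFn_mul {M : Type*} [Monoid M] {d : ℕ} (f g : Fin d → M)
    (h : ∀ i j, Commute (f i) (g j)) :
    (List.ofFn fun i => f i * g i).prod = (List.ofFn f).prod * (List.ofFn g).prod := by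
  induction d with
  | zero => simp
  | succ d ih =>
    simp only [List.ofFn_succ, List.prod_cons]
    rw [ih _ _ fun i j => h _ _]
    have : Commute (List.ofFn fun i : Fin d => f i.succ).prod (g 0) := by
      apply Commute.list_prod_left
      intro x hx
      obtain ⟨i, rfl⟩ := (List.mem_ofFn' _ _).1 hx
      exact h _ _
    simp only [mul_assoc]
    rw [← mul_assoc (g 0), ← this.eq, mul_assoc]

lemma List.prod_ofFn_pow_single {M : Type*} [Monoid M] {d : ℕ} (f : Fin d → M) (j : Fin d) :
    (List.ofFn fun i => f i ^ (Pi.single j 1 : Fin d → ℕ) i).prod = f j := by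
  induction d with
  | zero => exact j.elim0
  | succ d ih =>
    rw [List.ofFn_succ, List.prod_cons]
    refine Fin.cases ?_ (fun j => ?_) j
    · have : (fun i : Fin d => f i.succ ^ (Pi.single 0 1 : Fin (d + 1) → ℕ) i.succ)
          = fun _ => 1 := by
        ext i; simp
      rw [this]
      simp
    · have h1 : (fun i : Fin d => f i.succ ^ (Pi.single j.succ 1 : Fin (d + 1) → ℕ) i.succ)
          = fun i => f i.succ ^ (Pi.single j 1 : Fin d → ℕ) i := by
        ext i; simp [Pi.single_apply]
      rw [h1, ih (fun i => f i.succ) j]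
      simp

section opProd

variable {H : Type*} [NormedAddCommGroup H] [InnerProductSpace ℂ H] {d : ℕ}

lemma opProd_zero (T : Fin d → H →L[ℂ] H) : opProd T 0 = 1 := by
  simp [opProd]

lemma opProd_add_single {T : Fin d → H →L[ℂ] H} (hcomm : ∀ i j, Commute (T i) (T j))
    (α : Fin d → ℕ) (j : Fin d) : opProd T (α + Pi.single j 1) = T j * opProd T α := by
  have := List.prod_ofFn_mul (fun i => T i ^ (Pi.single j 1 : Fin d → ℕ) i) (fun i => T i ^ α i)
    fun i k => (hcomm i k).pow_pow _ _
  rw [List.prod_ofFn_pow_single] at this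
  rw [opProd, opProd, ← this]
  simp only [Pi.add_apply, add_comm (α _), pow_add]

lemma map_opProd_of_map_eq_smul {T : Fin d → H →L[ℂ] H} {Y : H → H} {z : ℂ}
    (hY : ∀ k x, Y (T k x) = z • T k (Y x)) (α : Fin d → ℕ) (x : H) :
    Y (opProd T α x) = z ^ (∑ i, α i) • opProd T α (Y x) := by
  have hpow : ∀ k n x, Y ((T k ^ n) x) = z ^ n • (T k ^ n) (Y x) := by
    intro k n
    induction n with
    | zero => simp
    | succ n ih =>
      intro x
      rw [pow_succ, mul_apply_eq_comp, ih, hY, map_smul, smul_smul, pow_succ, mul_apply_eq_comp]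
  unfold opProd
  clear hY
  induction d generalizing x with
  | zero => simp
  | succ d ih =>
    rw [List.ofFn_succ, List.prod_cons, mul_apply_eq_comp, hpow,
      ih (T := fun i => T i.succ) (fun i => α i.succ) x fun k => hpow k.succ, map_smul, smul_smul,
      Fin.sum_univ_succ, pow_add, mul_apply_eq_comp]

open Finset MvPolynomial in
/-- The adjoint form of the row contraction estimate in homogeneity degree `l`. -/
lemma sum_mcoef_norm_adjoint_opProd_le [CompleteSpace H] {T : Fin d → H →L[ℂ] H}
    (hcomm : ∀ i j, Commute (T i) (T j))
    (hrow : (1 - ∑ k, T k * adjoint (T k)).IsPositive) (l : ℕ) (y : H) :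
    ∑ α ∈ piAntidiag univ l, mcoef α * ‖adjoint (opProd T α) y‖ ^ 2 ≤ ‖y‖ ^ 2 := by
  let Λ : H → MvPolynomial (Fin d) ℝ →ₗ[ℝ] ℝ := fun y =>
    (basisMonomials (Fin d) ℝ).constr ℝ fun s => ‖adjoint (opProd T s) y‖ ^ 2
  have hΛ : ∀ y s, Λ y (monomial s 1) = ‖adjoint (opProd T s) y‖ ^ 2 := by
    intro y s
    have := (basisMonomials (Fin d) ℝ).constr_basis ℝ
      (fun s : Fin d →₀ ℕ => ‖adjoint (opProd T s) y‖ ^ 2) s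
    simpa [Λ] using! this
  have hΛX : ∀ y j P, Λ y (P * X j) = Λ (adjoint (T j) y) P := by
    intro y j P
    have : (Λ y).comp (LinearMap.mulRight ℝ (X j)) = Λ (adjoint (T j) y) := by
      refine (basisMonomials (Fin d) ℝ).ext fun s => ?_
      have hs : ((s + Finsupp.single j 1 : Fin d →₀ ℕ) : Fin d → ℕ) = (s : Fin d → ℕ) + Pi.single j 1 := by
        rw [Finsupp.coe_add, Finsupp.single_eq_pi_single]
      simp only [coe_basisMonomials, LinearMap.comp_apply, LinearMap.mulRight_apply]
      rw [X, monomial_mul, mul_one, hΛ, hΛ, hs, opProd_add_single hcomm, ← star_eq_adjoint,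
        star_mul]
      rfl
    rw [← this]
    rfl
  have hrow' : ∀ y, ∑ j, ‖adjoint (T j) y‖ ^ 2 ≤ ‖y‖ ^ 2 := by
    intro y
    have h := hrow.re_inner_nonneg_left y
    simp only [sub_apply, one_apply_eq_self, _root_.sum_apply, mul_apply_eq_comp, inner_sub_left, sum_inner, map_sub,
      map_sum] at h
    have hj : ∀ j, RCLike.re (inner ℂ (T j (adjoint (T j) y)) y) = ‖adjoint (T j) y‖ ^ 2 :=
      fun j => by rw [← adjoint_inner_right, inner_self_eq_norm_sq]
    simp_rw [hj, inner_self_eq_norm_sq] at h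
    linarith
  have hmain : ∀ l y, Λ y ((∑ j, X j) ^ l) ≤ ‖y‖ ^ 2 := by
    intro l
    induction l with
    | zero =>
      intro y
      have := hΛ y 0
      rw [Finsupp.coe_zero, opProd_zero] at this
      rw [pow_zero, MvPolynomial.one_def, this, ← star_eq_adjoint, star_one]
      rfl
    | succ l ih =>
      intro y
      rw [pow_succ, mul_sum, map_sum]
      simp_rw [hΛX]
      exact (sum_le_sum fun j _ => ih _).trans (hrow' y)
  refine le_trans (le_of_eq ?_) (hmain l y)
  rw [sum_pow_eq_sum_piAntidiag, map_sum]
  refine sum_congr rfl fun α _ => ?_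
  have hmon : (∏ i, (X i : MvPolynomial (Fin d) ℝ) ^ α i)
      = monomial (Finsupp.equivFunOnFinite.symm α) 1 := by
    rw [monomial_eq, Finsupp.prod_fintype _ _ (by simp)]
    simp
  have hcoef : mcoef α = (Nat.multinomial univ α : ℝ) := by
    rw [mcoef, ← Nat.multinomial_spec]
    push_cast
    exact mul_div_cancel_left₀ _ (prod_ne_zero_iff.2 fun i _ => by positivity)
  rw [hmon, ← nsmul_eq_mul, map_nsmul, hΛ, hcoef, nsmul_eq_mul]
  rfl

open Finset in
/-- The row contraction estimate in homogeneity degree `l`. -/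
lemma norm_sum_smul_opProd_sq_le [CompleteSpace H] {T : Fin d → H →L[ℂ] H}
    (hcomm : ∀ i j, Commute (T i) (T j))
    (hrow : (1 - ∑ k, T k * adjoint (T k)).IsPositive) {ξ : H} (hξ : ‖ξ‖ = 1)
    {l : ℕ} {s : Finset (Fin d → ℕ)} (hs : ∀ α ∈ s, ∑ i, α i = l) (c : (Fin d → ℕ) → ℂ) :
    ‖∑ α ∈ s, c α • ((Real.sqrt (mcoef α) : ℂ) • opProd T α ξ)‖ ^ 2 ≤ ∑ α ∈ s, ‖c α‖ ^ 2 := by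
  set v := ∑ α ∈ s, c α • ((Real.sqrt (mcoef α) : ℂ) • opProd T α ξ) with hv
  have hm : ∀ α : Fin d → ℕ, 0 ≤ mcoef α := fun α => by unfold mcoef; positivity
  have h1 : ‖v‖ ^ 2 ≤ ∑ α ∈ s, ‖c α‖ * (√(mcoef α) * ‖adjoint (opProd T α) v‖) := by
    have : ((‖v‖ ^ 2 : ℝ) : ℂ)
        = ∑ α ∈ s, c α * ((Real.sqrt (mcoef α) : ℂ) * inner ℂ (adjoint (opProd T α) v) ξ) := by
      rw [← inner_self_eq_ofReal_norm_sq]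
      conv_lhs => enter [3]; rw [hv]
      simp_rw [inner_sum, inner_smul_right, adjoint_inner_left]
    calc ‖v‖ ^ 2 = ‖((‖v‖ ^ 2 : ℝ) : ℂ)‖ := by
          rw [Complex.norm_real, Real.norm_of_nonneg (by positivity)]
      _ ≤ _ := by
          rw [this]
          refine (norm_sum_le _ _).trans (sum_le_sum fun α _ => ?_)
          rw [norm_mul, norm_mul, Complex.norm_real, Real.norm_of_nonneg (Real.sqrt_nonneg _)]
          gcongr
          simpa [hξ] using norm_inner_le_norm (𝕜 := ℂ) (adjoint (opProd T α) v) ξ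
  have h2 : ∑ α ∈ s, (√(mcoef α) * ‖adjoint (opProd T α) v‖) ^ 2 ≤ ‖v‖ ^ 2 := by
    refine le_trans ?_ (sum_mcoef_norm_adjoint_opProd_le hcomm hrow l v)
    simp_rw [mul_pow, Real.sq_sqrt (hm _)]
    refine sum_le_sum_of_subset_of_nonneg (fun α hα => ?_) fun α _ _ =>
      mul_nonneg (hm α) (sq_nonneg _)
    simp [mem_piAntidiag, hs α hα]
  have h3 : (‖v‖ ^ 2) ^ 2 ≤ (∑ α ∈ s, ‖c α‖ ^ 2) * ‖v‖ ^ 2 :=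
    calc (‖v‖ ^ 2) ^ 2 ≤ (∑ α ∈ s, ‖c α‖ * (√(mcoef α) * ‖adjoint (opProd T α) v‖)) ^ 2 := by
          gcongr
      _ ≤ _ := sum_mul_sq_le_sq_mul_sq _ _ _
      _ ≤ _ := by gcongr
  rcases (sq_nonneg ‖v‖).eq_or_lt with h0 | h0
  · rw [← h0]
    positivity
  · rw [sq (‖v‖ ^ 2)] at h3
    exact le_of_mul_le_mul_right h3 h0

end opProd

/-- two-sided norm estimates for combinations `h = ∑ c_α (|α|!/α!)^{1/2} N^α ξ`
for a nilpotent commuting row contraction `N` with a unit cyclic vector, a norm-controlled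
circle action, and the lower bounds (c). -/
theorem stmt16 {H : Type*} [NormedAddCommGroup H] [InnerProductSpace ℂ H] [CompleteSpace H]
    {d : ℕ} (N : Fin d → H →L[ℂ] H)
    (hcomm : ∀ i j, Commute (N i) (N j))
    (hnilp : ∀ j, ∃ m : ℕ, (N j) ^ m = 0)
    (hrow : (1 - ∑ k, N k * adjoint (N k)).IsPositive)
    (Ξ : Finset (Fin d → ℕ)) (hΞ : ∀ α : Fin d → ℕ, α ∈ Ξ ↔ opProd N α ≠ 0)
    (L : ℕ) (hL : ∀ α ∈ Ξ, (∑ i, α i) ≤ L)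
    -- (a) unit cyclic vector
    (ξ : H) (hξ : ‖ξ‖ = 1)
    (hcyc : Submodule.span ℂ {v : H | ∃ α : Fin d → ℕ, v = opProd N α ξ} = ⊤)
    -- (b) norm-controlled circle action
    (γ : ℝ) (hγ : 0 < γ)
    (hgauge : ∀ t ∈ Set.Icc (0 : ℝ) (2 * Real.pi), ∃ Y : H ≃L[ℂ] H,
      ‖(Y : H →L[ℂ] H)‖ ≤ γ ∧ Y.symm ξ = ξ ∧
      ∀ k, (Y : H →L[ℂ] H) * N k * (Y.symm : H →L[ℂ] H) =
        Complex.exp (t * Complex.I) • N k)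
    -- (c)
    (ε : ℝ) (hε : 0 < ε)
    (hbelow : ∀ α ∈ Ξ, 1 - ε ≤ mcoef α * ‖opProd N α ξ‖ ^ 2)
    (c : (Fin d → ℕ) → ℂ) :
    (1 - ε * Ξ.card) / ((L + 1) * γ ^ 2) * ∑ α ∈ Ξ, ‖c α‖ ^ 2 ≤
        ‖∑ α ∈ Ξ, c α • ((Real.sqrt (mcoef α) : ℂ) • opProd N α ξ)‖ ^ 2 ∧
      ‖∑ α ∈ Ξ, c α • ((Real.sqrt (mcoef α) : ℂ) • opProd N α ξ)‖ ^ 2 ≤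
        (L + 1) * ∑ α ∈ Ξ, ‖c α‖ ^ 2 := by
  classical
  set u : (Fin d → ℕ) → H := fun α => (Real.sqrt (mcoef α) : ℂ) • opProd N α ξ with hu
  set Ξl : ℕ → Finset (Fin d → ℕ) := fun l => Ξ.filter fun α => ∑ i, α i = l with hΞl
  set h : ℕ → H := fun l => ∑ α ∈ Ξl l, c α • u α with hh
  have hmaps : ∀ α ∈ Ξ, ∑ i, α i ∈ Finset.range (L + 1) := fun α hα =>
    Finset.mem_range_succ_iff.2 (hL α hα)
  have hdecomp : ∑ α ∈ Ξ, c α • u α = ∑ l ∈ Finset.range (L + 1), h l :=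
    (Finset.sum_fiberwise_of_maps_to hmaps _).symm
  have hcdecomp : ∑ α ∈ Ξ, ‖c α‖ ^ 2 = ∑ l ∈ Finset.range (L + 1), ∑ α ∈ Ξl l, ‖c α‖ ^ 2 :=
    (Finset.sum_fiberwise_of_maps_to hmaps _).symm
  have hdeg : ∀ l, ∀ α ∈ Ξl l, ∑ i, α i = l := fun l α hα => (Finset.mem_filter.1 hα).2
  have hupper : ∀ l (c : (Fin d → ℕ) → ℂ),
      ‖∑ α ∈ Ξl l, c α • u α‖ ^ 2 ≤ ∑ α ∈ Ξl l, ‖c α‖ ^ 2 := fun l c =>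
    norm_sum_smul_opProd_sq_le hcomm hrow hξ (hdeg l) c
  have hL1 : (0 : ℝ) < L + 1 := by positivity
  change _ ≤ ‖∑ α ∈ Ξ, c α • u α‖ ^ 2 ∧ ‖∑ α ∈ Ξ, c α • u α‖ ^ 2 ≤ _
  refine ⟨?_, ?_⟩
  · have hun : ∀ α ∈ Ξ, 1 - ε ≤ ‖u α‖ ^ 2 := by
      intro α hα
      have hm : 0 ≤ mcoef α := by unfold mcoef; positivity
      rw [hu, norm_smul, mul_pow, Complex.norm_real, Real.norm_of_nonneg (Real.sqrt_nonneg _),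
        Real.sq_sqrt hm]
      exact hbelow α hα
    have hlower : ∀ l, (1 - ε * Ξ.card) * ∑ α ∈ Ξl l, ‖c α‖ ^ 2 ≤ ‖h l‖ ^ 2 := by
      intro l
      have h1 := gram_lower_bound (fun α : Ξl l => u α) (ε := ε) (fun c' => by
          let c₀ : (Fin d → ℕ) → ℂ := fun α => if hα : α ∈ Ξl l then c' ⟨α, hα⟩ else 0
          have := hupper l c₀
          rw [← Finset.sum_coe_sort (Ξl l) fun α => c₀ α • u α,
            ← Finset.sum_coe_sort (Ξl l) fun α => ‖c₀ α‖ ^ 2] at this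
          simpa only [c₀, Finset.coe_mem, dite_true] using this)
        (fun α => hun α (Finset.mem_filter.1 α.2).1) (fun α => c α)
      rw [Fintype.card_coe, Finset.sum_coe_sort (Ξl l) fun α => ‖c α‖ ^ 2,
        Finset.sum_coe_sort (Ξl l) fun α => c α • u α] at h1
      refine le_trans ?_ h1
      gcongr
      exact Finset.filter_subset _ _
    set ω : ℂ := Complex.exp (2 * Real.pi * Complex.I / (L + 1 : ℕ)) with hω
    have hprim : IsPrimitiveRoot ω (L + 1) := Complex.isPrimitiveRoot_exp _ (by omega)
    have hgauge' : ∀ k ∈ Finset.range (L + 1),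
        ‖∑ l ∈ Finset.range (L + 1), (ω ^ k) ^ l • h l‖ ^ 2
          ≤ γ ^ 2 * ‖∑ l ∈ Finset.range (L + 1), h l‖ ^ 2 := by
      intro k hk
      have hk' : (k : ℝ) ≤ L + 1 := by exact_mod_cast (Finset.mem_range.1 hk).le
      obtain ⟨Y, hYγ, hYξ, hYN⟩ := hgauge (2 * Real.pi * (k / (L + 1)))
        ⟨by positivity, mul_le_of_le_one_right (by positivity) ((div_le_one hL1).2 hk')⟩
      have hexp : Complex.exp (((2 * Real.pi * (k / (L + 1)) : ℝ) : ℂ) * Complex.I) = ω ^ k := by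
        rw [hω, ← Complex.exp_nat_mul]
        congr 1
        push_cast
        ring
      rw [hexp] at hYN
      have hYξ' : Y ξ = ξ := by rw [← hYξ, Y.apply_symm_apply, hYξ]
      have hYT : ∀ j x, Y (N j x) = ω ^ k • N j (Y x) := by
        intro j x
        have := congrArg (fun S : H →L[ℂ] H => S (Y x)) (hYN j)
        simpa using! this
      have hYh : ∀ l, Y (h l) = (ω ^ k) ^ l • h l := by
        intro l
        simp only [hh, map_sum, Finset.smul_sum]
        refine Finset.sum_congr rfl fun α hα => ?_
        simp only [hu, map_smul]
        rw [map_opProd_of_map_eq_smul hYT, hYξ', hdeg l α hα, smul_comm (_ ^ l) (c α),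
          smul_comm (_ ^ l) (Complex.ofReal _)]
      have hsum : ∑ l ∈ Finset.range (L + 1), (ω ^ k) ^ l • h l
          = (Y : H →L[ℂ] H) (∑ l ∈ Finset.range (L + 1), h l) := by
        rw [map_sum]
        exact Finset.sum_congr rfl fun l _ => (hYh l).symm
      rw [hsum, ← mul_pow]
      gcongr
      exact le_of_opNorm_le _ hYγ _
    have hproj : ∑ l ∈ Finset.range (L + 1), ‖h l‖ ^ 2 ≤ γ ^ 2 * ‖∑ α ∈ Ξ, c α • u α‖ ^ 2 := by
      have h1 := Finset.sum_le_sum hgauge'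
      rw [sum_norm_sq_fourier hprim, ← hdecomp, Finset.sum_const, Finset.card_range,
        nsmul_eq_mul] at h1
      exact le_of_mul_le_mul_left h1 (by positivity)
    have hmain : (1 - ε * Ξ.card) * ∑ α ∈ Ξ, ‖c α‖ ^ 2 ≤ γ ^ 2 * ‖∑ α ∈ Ξ, c α • u α‖ ^ 2 := by
      refine le_trans ?_ hproj
      rw [hcdecomp, Finset.mul_sum]
      exact Finset.sum_le_sum fun l _ => hlower l
    rw [div_mul_eq_mul_div, div_le_iff₀ (by positivity)]
    refine hmain.trans ?_
    have : 0 ≤ L * (γ ^ 2 * ‖∑ α ∈ Ξ, c α • u α‖ ^ 2) := by positivity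
    linarith
  · rw [hdecomp, hcdecomp]
    calc ‖∑ l ∈ Finset.range (L + 1), h l‖ ^ 2
        ≤ (∑ l ∈ Finset.range (L + 1), ‖h l‖) ^ 2 := by
          gcongr
          exact norm_sum_le _ _
      _ ≤ (Finset.range (L + 1)).card * ∑ l ∈ Finset.range (L + 1), ‖h l‖ ^ 2 :=
          sq_sum_le_card_mul_sum_sq
      _ ≤ (L + 1) * ∑ l ∈ Finset.range (L + 1), ∑ α ∈ Ξl l, ‖c α‖ ^ 2 := by
          rw [Finset.card_range]
          push_cast
          gcongr with l
          exact hupper l c
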